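/- Let 𝒜 = {L_1, …, L_n} be n ≥ 1 pairwise distinct affine lines in ℂ² and let R be a commutative ring. Let c_1, …, c_n ∈ R be such that Σ_{i ∈ B} c_i = 0 for every parallel class B of 𝒜. Set ν = e_1 + ⋯ + e_n and η = c_1 e_1 + ⋯ + c_n e_n in Λ(R^n), and suppose ν ∧ η ∈ I_R(𝒜). Then for every parallel class C of 𝒜 such that (n − #C)·1_R is a unit of R, one has c_i = 0 for all i ∈ C. -/

import Mathlib

noncomputable section
open scoped Classical

/-- `L` is an (affine) line in `ℂ²`: a nonempty affine subspace whose direction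
has dimension one. -/
def IsLine (L : AffineSubspace ℂ (ℂ × ℂ)) : Prop :=
  (L : Set (ℂ × ℂ)).Nonempty ∧ Module.finrank ℂ L.direction = 1

/-- Indices `i`, `j` are parallel: `i = j` or the lines do not meet. -/
def Par {n : ℕ} (L : Fin n → AffineSubspace ℂ (ℂ × ℂ)) (i j : Fin n) : Prop :=
  i = j ∨ (L i : Set (ℂ × ℂ)) ∩ (L j : Set (ℂ × ℂ)) = ∅

/-- The image `e_i` of the `i`-th standard basis vector of `R^n` in `Λ(R^n)`. -/
def gen (R : Type*) [CommRing R] (n : ℕ) (i : Fin n) :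
    ExteriorAlgebra R (Fin n → R) :=
  ExteriorAlgebra.ι R (Pi.single i 1)

/-- Generators of the Orlik-Solomon ideal of the line arrangement `L`. -/
def osGens (R : Type*) [CommRing R] {n : ℕ}
    (L : Fin n → AffineSubspace ℂ (ℂ × ℂ)) :
    Set (ExteriorAlgebra R (Fin n → R)) :=
  {x | ∃ i j : Fin n, i ≠ j ∧ (L i : Set (ℂ × ℂ)) ∩ (L j : Set (ℂ × ℂ)) = ∅ ∧
        x = gen R n i * gen R n j} ∪
  {x | ∃ i j k : Fin n, i ≠ j ∧ i ≠ k ∧ j ≠ k ∧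
        ((L i : Set (ℂ × ℂ)) ∩ (L j : Set (ℂ × ℂ)) ∩ (L k : Set (ℂ × ℂ))).Nonempty ∧
        x = gen R n i * gen R n j - gen R n i * gen R n k + gen R n j * gen R n k}

/-- The Orlik-Solomon ideal `I_R(𝒜)`: the two-sided ideal generated by `osGens`. -/
def osIdeal (R : Type*) [CommRing R] {n : ℕ}
    (L : Fin n → AffineSubspace ℂ (ℂ × ℂ)) :
    TwoSidedIdeal (ExteriorAlgebra R (Fin n → R)) :=
  TwoSidedIdeal.span (osGens R L)

/-- The parallel class of the index `i`, as a finset of indices. -/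
def parClass {n : ℕ} (L : Fin n → AffineSubspace ℂ (ℂ × ℂ)) (i : Fin n) :
    Finset (Fin n) :=
  Finset.univ.filter (fun j => Par L i j)

/-- An alternating bilinear form `β` on `V` makes `V` act on `R × V × R` by square-zero
endomorphisms; the product of two vectors sends `(1, 0, 0)` to `(0, 0, β v w)`. -/
def formAction {R V : Type*} [CommRing R] [AddCommGroup V] [Module R V]
    (β : V →ₗ[R] V →ₗ[R] R) : V →ₗ[R] Module.End R (R × V × R) :=
  LinearMap.mk₂ R (fun v x => (0, x.1 • v, β v x.2.1))
    (by intros; simp) (by intro c v x; simp [smul_comm x.1]) (by intros; simp [add_smul])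
    (by intros; simp [mul_smul])

lemma formAction_mul_apply {R V : Type*} [CommRing R] [AddCommGroup V] [Module R V]
    (β : V →ₗ[R] V →ₗ[R] R) (v w : V) (x : R × V × R) :
    (formAction β v * formAction β w) x = (0, 0, x.1 * β v w) := by
  simp [formAction]

/-- The representation of the exterior algebra on `R × V × R` induced by an alternating form. -/
def formRep {R V : Type*} [CommRing R] [AddCommGroup V] [Module R V]
    (β : V →ₗ[R] V →ₗ[R] R) (hβ : ∀ v, β v v = 0) :
    ExteriorAlgebra R V →ₐ[R] Module.End R (R × V × R) :=
  ExteriorAlgebra.lift R ⟨formAction β, fun v => LinearMap.ext fun x => by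
    rw [formAction_mul_apply, hβ, mul_zero]; rfl⟩

lemma formRep_ι_mul_ι_apply {R V : Type*} [CommRing R] [AddCommGroup V] [Module R V]
    (β : V →ₗ[R] V →ₗ[R] R) (hβ : ∀ v, β v v = 0) (v w : V) (x : R × V × R) :
    formRep β hβ (ExteriorAlgebra.ι R v * ExteriorAlgebra.ι R w) x = (0, 0, x.1 * β v w) := by
  rw [map_mul, formRep, ExteriorAlgebra.lift_ι_apply, ExteriorAlgebra.lift_ι_apply,
    formAction_mul_apply]

/-- An alternating form that kills the quadratic relations of the Orlik-Solomon ideal kills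
every product of two vectors lying in the ideal. -/
lemma form_eq_zero_of_mul_mem_osIdeal {R : Type*} [CommRing R] {n : ℕ}
    {L : Fin n → AffineSubspace ℂ (ℂ × ℂ)}
    (β : (Fin n → R) →ₗ[R] (Fin n → R) →ₗ[R] R) (hβ : ∀ v, β v v = 0)
    (hpar : ∀ i j, i ≠ j → (L i : Set (ℂ × ℂ)) ∩ (L j : Set (ℂ × ℂ)) = ∅ →
      β (Pi.single i 1) (Pi.single j 1) = 0)
    (htriple : ∀ i j k, i ≠ j → i ≠ k → j ≠ k →
      ((L i : Set (ℂ × ℂ)) ∩ (L j : Set (ℂ × ℂ)) ∩ (L k : Set (ℂ × ℂ))).Nonempty →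
      β (Pi.single i 1) (Pi.single j 1) - β (Pi.single i 1) (Pi.single k 1)
        + β (Pi.single j 1) (Pi.single k 1) = 0)
    {v w : Fin n → R}
    (h : ExteriorAlgebra.ι R v * ExteriorAlgebra.ι R w ∈ osIdeal R L) : β v w = 0 := by
  have hle : osIdeal R L ≤ TwoSidedIdeal.ker (formRep β hβ) := by
    refine TwoSidedIdeal.span_le.2 ?_
    rintro x (⟨i, j, hij, he, rfl⟩ | ⟨i, j, k, hij, hik, hjk, hne, rfl⟩) <;>
      refine (TwoSidedIdeal.mem_ker _).2 (LinearMap.ext fun x => ?_)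
    · rw [gen, gen, formRep_ι_mul_ι_apply, hpar i j hij he, mul_zero]
      rfl
    · simp only [gen, map_add, map_sub, LinearMap.add_apply, LinearMap.sub_apply,
        formRep_ι_mul_ι_apply]
      have := htriple i j k hij hik hjk hne
      ext <;> simp [← mul_sub, ← mul_add, this]
  have h0 := (TwoSidedIdeal.mem_ker _).1 (hle h)
  have h1 := formRep_ι_mul_ι_apply β hβ v w (1, 0, 0)
  rw [h0] at h1
  simpa using (congrArg (fun x => x.2.2) h1).symm

/-- Lines of an arrangement are parallel exactly when their directions agree. -/
lemma par_iff_direction_eq {n : ℕ} {L : Fin n → AffineSubspace ℂ (ℂ × ℂ)}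
    (hline : ∀ i, IsLine (L i)) (hdist : Function.Injective L) (i j : Fin n) :
    Par L i j ↔ (L i).direction = (L j).direction := by
  constructor
  · rintro (rfl | h)
    · rfl
    by_contra hne
    have hi := (hline i).2
    have hj := (hline j).2
    refine Set.nonempty_iff_ne_empty.1
      (AffineSubspace.inter_nonempty_of_nonempty_of_sup_direction_eq_top
        (hline i).1 (hline j).1 ?_) h
    have hlt : (L i).direction < (L i).direction ⊔ (L j).direction := by
      refine lt_of_le_of_ne le_sup_left fun he => hne ?_
      exact (Submodule.eq_of_le_of_finrank_eq (sup_eq_left.1 he.symm) (hj.trans hi.symm)).symm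
    have h1 := Submodule.finrank_lt_finrank_of_lt hlt
    refine Submodule.eq_top_of_finrank_eq (le_antisymm (Submodule.finrank_le _) ?_)
    rw [Module.finrank_prod, Module.finrank_self]
    omega
  · intro h
    by_cases he : (L i : Set (ℂ × ℂ)) ∩ (L j : Set (ℂ × ℂ)) = ∅
    · exact Or.inr he
    · exact Or.inl (hdist (AffineSubspace.ext_of_direction_eq h
        (Set.nonempty_iff_ne_empty.2 he)))

/-- A function whose sums over the fibres of `f` all vanish has vanishing total sum. -/
lemma sum_eq_zero_of_fiberwise {ι α M : Type*} [Fintype ι] [AddCommMonoid M]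
    (f : ι → α) (c : ι → M)
    (h : ∀ i, ∑ j ∈ Finset.univ.filter (fun j => f i = f j), c j = 0) : ∑ j, c j = 0 := by
  rw [← Finset.sum_fiberwise_of_maps_to (fun i _ => Finset.mem_image_of_mem f (Finset.mem_univ i))]
  refine Finset.sum_eq_zero fun a ha => ?_
  obtain ⟨i, -, rfl⟩ := Finset.mem_image.1 ha
  simpa only [eq_comm] using h i

/-- The alternating form `s ∧ t` attached to two linear functionals. -/
def wedgeForm {R V : Type*} [CommRing R] [AddCommGroup V] [Module R V]
    (s t : V →ₗ[R] R) : V →ₗ[R] V →ₗ[R] R :=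
  LinearMap.mk₂ R (fun v w => s v * t w - t v * s w)
    (by intros; simp only [map_add]; ring)
    (by intros; simp only [map_smul, smul_eq_mul]; ring)
    (by intros; simp only [map_add]; ring)
    (by intros; simp only [map_smul, smul_eq_mul]; ring)

/-- The sum of the coordinates indexed by a finset, as a linear functional. -/
def coordSum (R : Type*) [CommRing R] {ι : Type*} (S : Finset ι) : (ι → R) →ₗ[R] R :=
  ∑ j ∈ S, LinearMap.proj j

lemma coordSum_apply {R : Type*} [CommRing R] {ι : Type*} (S : Finset ι) (v : ι → R) :
    coordSum R S v = ∑ j ∈ S, v j := by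
  simp [coordSum]

/-- If `ν ∧ η` lies in the Orlik-Solomon ideal, then the differences `c j - c i`, for `L j` not
parallel to `L i`, sum to zero. -/
lemma card_mul_eq_sum_of_mem_osIdeal {R : Type*} [CommRing R] {n : ℕ}
    {L : Fin n → AffineSubspace ℂ (ℂ × ℂ)} {c : Fin n → R}
    (h : (∑ i, gen R n i) * (∑ i, c i • gen R n i) ∈ osIdeal R L) (i : Fin n) :
    ((parClass L i)ᶜ.card : R) * c i = ∑ j ∈ (parClass L i)ᶜ, c j := by
  have hη (d : Fin n → R) : ∑ i, d i • gen R n i = ExteriorAlgebra.ι R d := by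
    conv_rhs => rw [pi_eq_sum_univ' d]
    simp only [map_sum, map_smul, gen]
  have hν : ∑ i, gen R n i = ExteriorAlgebra.ι R (1 : Fin n → R) := by
    simp [← hη]
  rw [hη, hν] at h
  have hsingle (a : Fin n) : coordSum R (parClass L i)ᶜ (Pi.single a 1) =
      if Par L i a then 0 else 1 := by
    simp [coordSum_apply, parClass]
  have key := form_eq_zero_of_mul_mem_osIdeal
    (wedgeForm (coordSum R (parClass L i)ᶜ) (LinearMap.proj i))
    (fun v => by simp [wedgeForm, mul_comm]) ?_ ?_ h
  · simpa [wedgeForm, coordSum_apply, sub_eq_zero] using key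
  · intro a b hab he
    simp only [wedgeForm, LinearMap.mk₂_apply, hsingle, LinearMap.proj_apply, Pi.single_apply]
    have h1 : i = b → Par L i a := by rintro rfl; exact Or.inr (Set.inter_comm _ _ ▸ he)
    have h2 : i = a → Par L i b := by rintro rfl; exact Or.inr he
    split_ifs <;> simp_all
  · rintro a b d hab had hbd ⟨p, ⟨hpa, hpb⟩, hpd⟩
    have hnot {x y : Fin n} (hxy : x ≠ y) (hx : p ∈ L x) (hy : p ∈ L y) : ¬ Par L x y := by
      rintro (h | h)
      · exact hxy h
      · exact (h ▸ (⟨hx, hy⟩ : p ∈ (L x : Set (ℂ × ℂ)) ∩ L y) : p ∈ (∅ : Set (ℂ × ℂ)))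
    simp only [wedgeForm, LinearMap.mk₂_apply, hsingle, LinearMap.proj_apply, Pi.single_apply]
    rcases eq_or_ne i a with rfl | hia
    · simp [hnot hab hpa hpb, hnot had hpa hpd, hab, had]
    rcases eq_or_ne i b with rfl | hib
    · simp [hnot hab.symm hpb hpa, hnot hbd hpb hpd, hia, hbd]
    rcases eq_or_ne i d with rfl | hid
    · simp [hnot had.symm hpd hpa, hnot hbd.symm hpd hpb, hia, hib]
    · simp [hia, hib, hid]

/-- Suppose the coefficients `cᵢ` sum to zero over every parallel
class of `𝒜`, and `ν ∧ η ∈ I_R(𝒜)` where `ν = Σ eᵢ` and `η = Σ cᵢeᵢ`. Then for every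
parallel class `C` such that `(n - #C)·1_R` is a unit, all coefficients `cᵢ`, `i ∈ C`,
vanish. -/
theorem directional_degeneration_vanishing
    {n : ℕ} (hn : 1 ≤ n) (L : Fin n → AffineSubspace ℂ (ℂ × ℂ))
    (hline : ∀ i, IsLine (L i)) (hdist : Function.Injective L)
    (R : Type*) [CommRing R] (c : Fin n → R)
    (hc : ∀ i : Fin n, ∑ j ∈ parClass L i, c j = 0)
    (hker : (∑ i, gen R n i) * (∑ i, c i • gen R n i) ∈ osIdeal R L) :
    ∀ i : Fin n, IsUnit ((n - (parClass L i).card : ℕ) : R) →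
      ∀ j : Fin n, Par L i j → c j = 0 := by
  intro i hu j hij
  have hclass : parClass L j = parClass L i := by
    ext k
    simp only [parClass, Finset.mem_filter, par_iff_direction_eq hline hdist] at hij ⊢
    rw [hij]
  rw [← hclass] at hu
  have htotal : ∑ k, c k = 0 :=
    sum_eq_zero_of_fiberwise (fun k => (L k).direction) c fun k =>
      (Finset.sum_congr (by ext; simp [parClass, par_iff_direction_eq hline hdist])
        fun _ _ => rfl).trans (hc k)
  have hcompl : ∑ k ∈ (parClass L j)ᶜ, c k = 0 := by
    rw [← Finset.sum_add_sum_compl (parClass L j), hc j, zero_add] at htotal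
    exact htotal
  have h := card_mul_eq_sum_of_mem_osIdeal hker j
  rw [hcompl, Finset.card_compl, Fintype.card_fin] at h
  exact hu.mul_right_eq_zero.1 h
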